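/- Approximate decorrelation under the Markov-domination condition: Fix an orthonormal basis (e_p)_{p=1}^d of ℂ^d, let π_p := |e_p⟩⟨e_p|, set λ_k(i,i';p) := Tr(π_p σ_k(i,i')), and define the probability distribution P on {1,…,d}^m by P((p_1,…,p_m)) := ∑_{i_1,…,i_{m+1}∈I} γ_{i_1} ∏_{k=1}^m λ_k(i_k,i_{k+1};p_k). Assume conditions (i), (ii) and the upper domination bound σ_k(i,i') ≤ (1+δ³) γ_{i'} σ_k(i) for all k,i,i'. Then for all 1 ≤ k < l ≤ m and every p ∈ {1,…,d}: P(p_k = p and p_l = p) ≤ (1+δ³) · (∑_{i∈I} γ_i Tr(π_p σ_k(i))) · (∑_{i∈I} γ_i Tr(π_p σ_l(i))). -/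

import Mathlib

open scoped BigOperators ComplexOrder Matrix

/-- The rank-one projection `|v⟩⟨v|` onto a (unit) vector `v ∈ ℂ^d`. -/
noncomputable def outerProj {d : ℕ} (v : Fin d → ℂ) : Matrix (Fin d) (Fin d) ℂ :=
  Matrix.vecMulVec v (star v)

/-- The tensor product `A₁ ⊗ ⋯ ⊗ A_m` of `d × d` matrices, as a matrix on
`(ℂ^d)^{⊗m} ≃ ℂ^(Fin m → Fin d)`. -/
noncomputable def matTensor {m d : ℕ} (A : Fin m → Matrix (Fin d) (Fin d) ℂ) :
    Matrix (Fin m → Fin d) (Fin m → Fin d) ℂ :=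
  Matrix.of fun x y => ∏ k, A k (x k) (y k)

/-- The Markov-correlated state
`σ^{(m)} = ∑_{i₁,…,i_{m+1}} γ_{i₁} σ₁(i₁,i₂) ⊗ ⋯ ⊗ σ_m(i_m,i_{m+1})`. -/
noncomputable def sigmaChain {I : Type*} [Fintype I] {d m : ℕ} (γ : I → ℝ)
    (σ : Fin m → I → I → Matrix (Fin d) (Fin d) ℂ) :
    Matrix (Fin m → Fin d) (Fin m → Fin d) ℂ :=
  ∑ i : Fin (m + 1) → I,
    ((γ (i 0) : ℂ)) • matTensor (fun k => σ k (i k.castSucc) (i k.succ))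

/-- The measurement distribution
`P((p₁,…,p_m)) = ∑_{i₁,…,i_{m+1}} γ_{i₁} ∏ₖ λₖ(iₖ,i_{k+1}; pₖ)` with
`λₖ(i,i';p) = Tr(πₖ(p) σₖ(i,i'))`. -/
noncomputable def measP {I : Type*} [Fintype I] {d m : ℕ} (γ : I → ℝ)
    (σ : Fin m → I → I → Matrix (Fin d) (Fin d) ℂ)
    (π : Fin m → Fin d → Matrix (Fin d) (Fin d) ℂ) (p : Fin m → Fin d) : ℝ :=
  ∑ i : Fin (m + 1) → I,
    γ (i 0) * ∏ k, (Matrix.trace (π k (p k) * σ k (i k.castSucc) (i k.succ))).re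

/-- Chain sum with start vector `v`. -/
noncomputable def chainZ {I : Type*} [Fintype I] (m : ℕ) (w : Fin m → I → I → ℝ) (v : I → ℝ) : ℝ :=
  ∑ i : Fin (m + 1) → I, v (i 0) * ∏ k, w k (i k.castSucc) (i k.succ)

theorem chainZ_zero {I : Type*} [Fintype I] (w : Fin 0 → I → I → ℝ) (v : I → ℝ) :
    chainZ 0 w v = ∑ i, v i := by
  unfold chainZ
  rw [← (Equiv.funUnique (Fin 1) I).symm.sum_comp]
  simp

theorem chainZ_succ {I : Type*} [Fintype I] (m : ℕ) (w : Fin (m + 1) → I → I → ℝ) (v : I → ℝ) :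
    chainZ (m + 1) w v =
      chainZ m (fun j => w j.succ) (fun i' => ∑ i, v i * w 0 i i') := by
  unfold chainZ
  rw [← (Fin.consEquiv (fun _ : Fin (m + 2) => I)).sum_comp, Fintype.sum_prod_type,
    Finset.sum_comm]
  refine Finset.sum_congr rfl fun y _ => ?_
  rw [Finset.sum_mul]
  refine Finset.sum_congr rfl fun x _ => ?_
  rw [Fin.prod_univ_succ]
  simp [Fin.consEquiv, ← Fin.succ_castSucc, mul_assoc]

theorem chainZ_mono {I : Type*} [Fintype I] (m : ℕ) (w : Fin m → I → I → ℝ)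
    (hw : ∀ j i i', 0 ≤ w j i i') (v v' : I → ℝ) (h : ∀ i, v i ≤ v' i) :
    chainZ m w v ≤ chainZ m w v' := by
  unfold chainZ
  refine Finset.sum_le_sum fun i _ => ?_
  exact mul_le_mul_of_nonneg_right (h _) (Finset.prod_nonneg fun j _ => hw _ _ _)

theorem chainZ_smul {I : Type*} [Fintype I] (m : ℕ) (w : Fin m → I → I → ℝ)
    (c : ℝ) (v : I → ℝ) : chainZ m w (fun i => c * v i) = c * chainZ m w v := by
  unfold chainZ
  simp [Finset.mul_sum, mul_assoc]

theorem chainZ_stoch {I : Type*} [Fintype I] (m : ℕ) (w : Fin m → I → I → ℝ)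
    (hs : ∀ j i, ∑ i', w j i i' = 1) (v : I → ℝ) : chainZ m w v = ∑ i, v i := by
  induction m generalizing v with
  | zero => exact chainZ_zero w v
  | succ m ih =>
    rw [chainZ_succ, ih _ (fun j i => hs _ _), Finset.sum_comm]
    simp [← Finset.mul_sum, hs]

theorem chainZ_one {I : Type*} [Fintype I] (m : ℕ) (w : Fin m → I → I → ℝ)
    (γ : I → ℝ) (l : Fin m)
    (hs : ∀ j, j ≠ l → ∀ i, ∑ i', w j i i' = 1)
    (ht : ∀ j, j ≠ l → ∀ i', ∑ i, γ i * w j i i' = γ i') :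
    chainZ m w γ = ∑ i, γ i * ∑ i', w l i i' := by
  induction m with
  | zero => exact l.elim0
  | succ m ih =>
    rw [chainZ_succ]
    cases l using Fin.cases with
    | zero =>
      rw [chainZ_stoch _ _ (fun j i => hs _ (Fin.succ_ne_zero j) i), Finset.sum_comm]
      simp [Finset.mul_sum]
    | succ l =>
      simp only [ht 0 (Fin.succ_ne_zero l).symm]
      exact ih _ l (fun j hj => hs _ (by simpa using hj)) (fun j hj => ht _ (by simpa using hj))

theorem chainZ_two {I : Type*} [Fintype I] (m : ℕ) (w : Fin m → I → I → ℝ)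
    (hw : ∀ j i i', 0 ≤ w j i i')
    (γ : I → ℝ) (hγ : ∀ i, 0 ≤ γ i) (c : ℝ) (k l : Fin m) (hkl : k < l)
    (hs : ∀ j, j ≠ k → j ≠ l → ∀ i, ∑ i', w j i i' = 1)
    (ht : ∀ j, j ≠ k → j ≠ l → ∀ i', ∑ i, γ i * w j i i' = γ i')
    (hd : ∀ i i', w k i i' ≤ c * γ i' * ∑ i'', w k i i'') :
    chainZ m w γ ≤ c * (∑ i, γ i * ∑ i', w k i i') * (∑ i, γ i * ∑ i', w l i i') := by
  induction m with
  | zero => exact l.elim0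
  | succ m ih =>
    rw [chainZ_succ]
    cases l using Fin.cases with
    | zero => exact absurd hkl (by simp)
    | succ l =>
      cases k using Fin.cases with
      | zero =>
        rw [← chainZ_one m (fun j => w j.succ) γ l
          (fun j hj => hs _ (Fin.succ_ne_zero j) (by simpa using hj))
          (fun j hj => ht _ (Fin.succ_ne_zero j) (by simpa using hj)), ← chainZ_smul]
        refine chainZ_mono _ _ (fun j => hw _) _ _ fun i' => ?_
        calc ∑ i, γ i * w 0 i i' ≤ ∑ i, γ i * (c * γ i' * ∑ i'', w 0 i i'') :=
              Finset.sum_le_sum fun i _ => mul_le_mul_of_nonneg_left (hd i i') (hγ i)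
          _ = _ := by
              rw [Finset.mul_sum, Finset.sum_mul]
              exact Finset.sum_congr rfl fun i _ => by ring
      | succ k =>
        simp only [ht 0 (Fin.succ_ne_zero k).symm (Fin.succ_ne_zero l).symm]
        exact ih _ (fun j => hw _) k l (by simpa using hkl)
          (fun j hj hj' => hs _ (by simpa using hj) (by simpa using hj'))
          (fun j hj hj' => ht _ (by simpa using hj) (by simpa using hj')) hd

theorem trace_outerProj_nonneg {d : ℕ} (v : Fin d → ℂ) (A : Matrix (Fin d) (Fin d) ℂ)
    (hA : A.PosSemidef) : 0 ≤ (Matrix.trace (outerProj v * A)).re := by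
  have h : Matrix.trace (outerProj v * A) = star v ⬝ᵥ (A *ᵥ v) := by
    rw [outerProj, Matrix.trace_mul_comm, Matrix.mul_vecMulVec, Matrix.trace_vecMulVec,
      dotProduct_comm]
  rw [h]
  exact (Complex.le_def.1 (hA.dotProduct_mulVec_nonneg v)).1

theorem sum_outerProj {d : ℕ} (e : Fin d → Fin d → ℂ)
    (horth : ∀ p q, (star (e p)) ⬝ᵥ e q = if p = q then 1 else 0) :
    ∑ p, outerProj (e p) = 1 := by
  let U : Matrix (Fin d) (Fin d) ℂ := Matrix.of fun a p => e p a
  have h : Uᴴ * U = 1 := by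
    ext p q
    rw [Matrix.one_apply, ← horth p q]
    rfl
  have h2 := mul_eq_one_comm.1 h
  rw [← h2]
  ext a b
  simp [Matrix.sum_apply, outerProj, Matrix.vecMulVec_apply, Matrix.mul_apply, U]

/-- Approximate decorrelation under the Markov-domination condition: under conditions
(i), (ii) and the upper bound `σ_k(i,i') ≤ (1+δ³) γ_{i'} σ_k(i)`, the joint probability
`P(p_k = p ∧ p_l = p)` is at most `(1+δ³)` times the product of the marginals. -/
theorem measP_decorrelation {I : Type*} [Fintype I] {d m : ℕ}
    (γ : I → ℝ) (hγ0 : ∀ i, 0 ≤ γ i) (hγ1 : ∑ i, γ i = 1) (δ : ℝ) (hδ : 0 < δ)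
    (σ : Fin m → I → I → Matrix (Fin d) (Fin d) ℂ)
    (hpsd : ∀ k i i', (σ k i i').PosSemidef)
    (hi : ∀ k i', ∑ i, (γ i : ℂ) * Matrix.trace (σ k i i') = (γ i' : ℂ))
    (hii : ∀ k i, Matrix.trace (∑ i', σ k i i') = 1)
    (hdom : ∀ k i i',
      ((((1 + δ ^ 3) * γ i' : ℝ) : ℂ) • (∑ i'', σ k i i'') - σ k i i').PosSemidef)
    (e : Fin d → Fin d → ℂ)
    (horth : ∀ p q, (star (e p)) ⬝ᵥ e q = if p = q then 1 else 0)
    (k l : Fin m) (hkl : k < l) (p : Fin d) :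
    ∑ pp ∈ Finset.univ.filter fun pp : Fin m → Fin d => pp k = p ∧ pp l = p,
        measP γ σ (fun _ r => outerProj (e r)) pp ≤
      (1 + δ ^ 3) * (∑ i, γ i * (Matrix.trace (outerProj (e p) * ∑ i', σ k i i')).re) *
        (∑ i, γ i * (Matrix.trace (outerProj (e p) * ∑ i', σ l i i')).re) := by
  classical
  set lam : Fin m → I → I → Fin d → ℝ :=
    fun j i i' r => (Matrix.trace (outerProj (e r) * σ j i i')).re with hlam
  have hlam0 : ∀ j i i' r, 0 ≤ lam j i i' r := fun j i i' r =>
    trace_outerProj_nonneg _ _ (hpsd j i i')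
  have hsum : ∀ j i i', ∑ r, lam j i i' r = (Matrix.trace (σ j i i')).re := by
    intro j i i'
    simp only [hlam]
    rw [← Complex.re_sum, ← Matrix.trace_sum, ← Finset.sum_mul, sum_outerProj e horth, one_mul]
  have hmarg : ∀ j i, (Matrix.trace (outerProj (e p) * ∑ i', σ j i i')).re
      = ∑ i', lam j i i' p := by
    intro j i
    simp only [hlam]
    rw [Finset.mul_sum, Matrix.trace_sum, Complex.re_sum]
  let t : Fin m → Finset (Fin d) := fun j => if j = k ∨ j = l then {p} else Finset.univ
  let w : Fin m → I → I → ℝ := fun j i i' => ∑ r ∈ t j, lam j i i' r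
  have hwk : ∀ i i', w k i i' = lam k i i' p := fun i i' => by simp [w, t]
  have hwl : ∀ i i', w l i i' = lam l i i' p := fun i i' => by simp [w, t]
  have hwj : ∀ j, j ≠ k → j ≠ l → ∀ i i', w j i i' = (Matrix.trace (σ j i i')).re := by
    intro j h1 h2 i i'
    simp [w, t, h1, h2, hsum]
  have hfilter : (Finset.univ.filter fun pp : Fin m → Fin d => pp k = p ∧ pp l = p)
      = Fintype.piFinset t := by
    ext pp
    simp only [Finset.mem_filter, Finset.mem_univ, true_and, Fintype.mem_piFinset, t]
    constructor
    · rintro ⟨h1, h2⟩ j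
      split_ifs with h
      · rcases h with rfl | rfl <;> simpa
      · simp
    · intro h
      exact ⟨by simpa using h k, by simpa using h l⟩
  have hL : ∑ pp ∈ Finset.univ.filter fun pp : Fin m → Fin d => pp k = p ∧ pp l = p,
        measP γ σ (fun _ r => outerProj (e r)) pp = chainZ m w γ := by
    rw [hfilter]
    unfold measP chainZ
    rw [Finset.sum_comm]
    refine Finset.sum_congr rfl fun i _ => ?_
    rw [← Finset.mul_sum, Finset.prod_univ_sum]
  rw [hL]
  simp only [hmarg]
  have key := chainZ_two m w (fun j i i' => Finset.sum_nonneg fun r _ => hlam0 j i i' r)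
    γ hγ0 (1 + δ ^ 3) k l hkl ?_ ?_ ?_
  · simpa only [hwk, hwl] using key
  · intro j h1 h2 i
    simp only [hwj j h1 h2]
    rw [← Complex.re_sum, ← Matrix.trace_sum, hii, Complex.one_re]
  · intro j h1 h2 i'
    simp only [hwj j h1 h2]
    have := congrArg Complex.re (hi j i')
    simpa using this
  · intro i i'
    simp only [hwk]
    rw [← hmarg]
    have := trace_outerProj_nonneg (e p) _ (hdom k i i')
    rw [mul_sub, Matrix.trace_sub, Matrix.mul_smul, Matrix.trace_smul, Complex.sub_re,
      smul_eq_mul, Complex.re_ofReal_mul] at this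
    simpa only [hlam] using sub_nonneg.1 this
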